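/- arXiv:0704.2838 — 2 statements merged into one kernel-verified Lean document; each statement's English description precedes it below -/
import Mathlib

section
/- For all integers k, l, m and both signs ε ∈ {+,−} (write σ = 1 if ε = + and σ = −1 if ε = −), the operators of the context satisfy the Drinfeld–Serre relations: Σ_{(a,b,c) a permutation of (k,l,m)} ( t³·x_{a−σ}^ε x_b^ε x_c^ε − (t + t^{-1})·x_a^ε x_{b−σ}^ε x_c^ε + t^{-3}·x_a^ε x_b^ε x_{c−σ}^ε ) = 0, and Σ_{(a,b,c) a permutation of (k,l,m)} ( t^{-3}·x_{a+σ}^ε x_b^ε x_c^ε − (t + t^{-1})·x_a^ε x_{b+σ}^ε x_c^ε + t³·x_a^ε x_b^ε x_{c+σ}^ε ) = 0 (the conjectural Drinfeld–Serre relations (16) and (17) of type A_2^{(2)} hold on the 6-dimensional Kirillov–Reshetikhin module W_{2,1}). -/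
noncomputable section

/-- `[4]_t = (t⁴ - t⁻⁴)/(t - t⁻¹)`. -/
def tfour (t : ℂ) : ℂ := (t ^ 4 - t⁻¹ ^ 4) / (t - t⁻¹)

/-- `ν = q^{-3/2}(1+q)(1-q+q²-q³+q⁴)/(1-q+q²)` with `q = t²`, `q^{-3/2} = t⁻³`. -/
def nuC (t : ℂ) : ℂ :=
  t⁻¹ ^ 3 * (1 + t ^ 2) * (1 - t ^ 2 + t ^ 4 - t ^ 6 + t ^ 8) / (1 - t ^ 2 + t ^ 4)

/-- `μ = q^{-1/2}(1+q²)(1+q)/(1-q+q²)` with `q = t²`, `q^{-1/2} = t⁻¹`. -/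
def muC (t : ℂ) : ℂ := t⁻¹ * (1 + t ^ 4) * (1 + t ^ 2) / (1 - t ^ 2 + t ^ 4)

/-- `q = t²` (so that the half-integer powers of `q` make sense as powers of `t`). -/
def qC (t : ℂ) : ℂ := t ^ 2

/-- The Drinfeld generator `x_r⁺` acting on the Kirillov–Reshetikhin module
`W_{2,1} = ℂ⁶` of type `A₂⁽²⁾`. -/
def xp (t : ℂ) (r : ℤ) : Matrix (Fin 6) (Fin 6) ℂ :=
  !![0, qC t ^ (3 * r), 0, 0, 0, 0;
     0, 0, (-qC t ^ 4) ^ r * nuC t, qC t ^ r * muC t, 0, 0;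
     0, 0, 0, 0, qC t ^ r, 0;
     0, 0, 0, 0, (-qC t ^ 4) ^ r, 0;
     0, 0, 0, 0, 0, tfour t * (-qC t ^ 2) ^ r;
     0, 0, 0, 0, 0, 0]

/-- The Drinfeld generator `x_r⁻` acting on the Kirillov–Reshetikhin module
`W_{2,1} = ℂ⁶` of type `A₂⁽²⁾`. -/
def xm (t : ℂ) (r : ℤ) : Matrix (Fin 6) (Fin 6) ℂ :=
  !![0, 0, 0, 0, 0, 0;
     qC t ^ (3 * r) * tfour t, 0, 0, 0, 0, 0;
     0, (-qC t ^ 4) ^ r, 0, 0, 0, 0;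
     0, qC t ^ r, 0, 0, 0, 0;
     0, 0, nuC t * qC t ^ r, muC t * (-qC t ^ 4) ^ r, 0, 0;
     0, 0, 0, 0, (-qC t ^ 2) ^ r, 0]

/-- The left-hand side of the Drinfeld–Serre relation (16):
`Σ_{(a,b,c) perm of (k,l,m)} ( t³ x_{a-σ} x_b x_c - (t+t⁻¹) x_a x_{b-σ} x_c + t⁻³ x_a x_b x_{c-σ} )`. -/
def serre16 (t : ℂ) (x : ℤ → Matrix (Fin 6) (Fin 6) ℂ) (σ : ℤ) (k l m : ℤ) :
    Matrix (Fin 6) (Fin 6) ℂ :=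
  ∑ π : Equiv.Perm (Fin 3),
    (t ^ 3 • (x (![k, l, m] (π 0) - σ) * x (![k, l, m] (π 1)) * x (![k, l, m] (π 2)))
      - (t + t⁻¹) • (x (![k, l, m] (π 0)) * x (![k, l, m] (π 1) - σ) * x (![k, l, m] (π 2)))
      + t⁻¹ ^ 3 • (x (![k, l, m] (π 0)) * x (![k, l, m] (π 1)) * x (![k, l, m] (π 2) - σ)))

/-- The left-hand side of the Drinfeld–Serre relation (17):
`Σ_{(a,b,c) perm of (k,l,m)} ( t⁻³ x_{a+σ} x_b x_c - (t+t⁻¹) x_a x_{b+σ} x_c + t³ x_a x_b x_{c+σ} )`. -/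
def serre17 (t : ℂ) (x : ℤ → Matrix (Fin 6) (Fin 6) ℂ) (σ : ℤ) (k l m : ℤ) :
    Matrix (Fin 6) (Fin 6) ℂ :=
  ∑ π : Equiv.Perm (Fin 3),
    (t⁻¹ ^ 3 • (x (![k, l, m] (π 0) + σ) * x (![k, l, m] (π 1)) * x (![k, l, m] (π 2)))
      - (t + t⁻¹) • (x (![k, l, m] (π 0)) * x (![k, l, m] (π 1) + σ) * x (![k, l, m] (π 2)))
      + t ^ 3 • (x (![k, l, m] (π 0)) * x (![k, l, m] (π 1)) * x (![k, l, m] (π 2) + σ)))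


theorem sum_perm_three {M : Type*} [AddCommMonoid M] (f : Fin 3 → Fin 3 → Fin 3 → M) :
    ∑ π : Equiv.Perm (Fin 3), f (π 0) (π 1) (π 2)
      = f 0 1 2 + f 0 2 1 + f 1 0 2 + f 1 2 0 + f 2 0 1 + f 2 1 0 := by
  have h : (Finset.univ : Finset (Equiv.Perm (Fin 3))) =
      {1, Equiv.swap 1 2, Equiv.swap 0 1, Equiv.swap 0 1 * Equiv.swap 1 2,
        Equiv.swap 1 2 * Equiv.swap 0 1, Equiv.swap 0 2} := by decide
  rw [h, Finset.sum_insert (by decide), Finset.sum_insert (by decide),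
    Finset.sum_insert (by decide), Finset.sum_insert (by decide),
    Finset.sum_insert (by decide), Finset.sum_singleton]
  have e1 : (Equiv.swap 1 2 : Equiv.Perm (Fin 3)) 0 = 0 := by decide
  have e2 : (Equiv.swap 0 1 : Equiv.Perm (Fin 3)) 2 = 2 := by decide
  have e3 : (Equiv.swap 0 2 : Equiv.Perm (Fin 3)) 1 = 1 := by decide
  simp [e1, e2, e3, add_assoc]

/-- The matrix `x_r⁺` in terms of `P = q^r` and `e = (-1)^r`. -/
def xpA (Q n u P e : ℂ) : Matrix (Fin 6) (Fin 6) ℂ :=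
  !![0, P ^ 3, 0, 0, 0, 0;
     0, 0, e * P ^ 4 * n, P * u, 0, 0;
     0, 0, 0, 0, P, 0;
     0, 0, 0, 0, e * P ^ 4, 0;
     0, 0, 0, 0, 0, Q * (e * P ^ 2);
     0, 0, 0, 0, 0, 0]

def xmA (Q n u P e : ℂ) : Matrix (Fin 6) (Fin 6) ℂ :=
  !![0, 0, 0, 0, 0, 0;
     P ^ 3 * Q, 0, 0, 0, 0, 0;
     0, e * P ^ 4, 0, 0, 0, 0;
     0, P, 0, 0, 0, 0;
     0, 0, n * P, u * (e * P ^ 4), 0, 0;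
     0, 0, 0, 0, e * P ^ 2, 0]

theorem neg_zpow_aux (q : ℂ) (n : ℕ) (r : ℤ) :
    (-q ^ n) ^ r = (-1) ^ r * (q ^ r) ^ n := by
  rw [neg_eq_neg_one_mul, mul_zpow, ← zpow_natCast q n, ← zpow_mul, ← zpow_natCast (q ^ r) n,
    ← zpow_mul, mul_comm r]

theorem pow3_aux (q : ℂ) (r : ℤ) : q ^ (3 * r) = (q ^ r) ^ 3 := by
  rw [mul_comm, zpow_mul]; norm_cast

theorem xp_eq (t : ℂ) (r : ℤ) :
    xp t r = xpA (tfour t) (nuC t) (muC t) (qC t ^ r) ((-1) ^ r) := by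
  simp only [xp, xpA, neg_zpow_aux, pow3_aux]

theorem xm_eq (t : ℂ) (r : ℤ) :
    xm t r = xmA (tfour t) (nuC t) (muC t) (qC t ^ r) ((-1) ^ r) := by
  simp only [xm, xmA, neg_zpow_aux, pow3_aux]

theorem xpA_mul (Q n u P e P' e' P'' e'' : ℂ) :
    xpA Q n u P e * xpA Q n u P' e' * xpA Q n u P'' e'' =
    Matrix.single 0 4 (P ^ 3 * (e' * P' ^ 4 * n * P'' + P' * u * (e'' * P'' ^ 4)))
    + Matrix.single 1 5 ((e * P ^ 4 * n * P' + P * u * (e' * P' ^ 4)) * (Q * (e'' * P'' ^ 2))) := by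
  ext i j
  fin_cases i <;> fin_cases j <;>
    simp [xpA, Matrix.mul_apply, Fin.sum_univ_succ, Matrix.single_apply] <;> ring

theorem xmA_mul (Q n u P e P' e' P'' e'' : ℂ) :
    xmA Q n u P e * xmA Q n u P' e' * xmA Q n u P'' e'' =
    Matrix.single 4 0 ((n * P * (e' * P' ^ 4) + u * (e * P ^ 4) * P') * (P'' ^ 3 * Q))
    + Matrix.single 5 1 (e * P ^ 2 * (n * P' * (e'' * P'' ^ 4) + u * (e' * P' ^ 4) * P'')) := by
  ext i j
  fin_cases i <;> fin_cases j <;>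
    simp [xmA, Matrix.mul_apply, Fin.sum_univ_succ, Matrix.single_apply] <;> ring

theorem serre16_eq (t : ℂ) (x : ℤ → Matrix (Fin 6) (Fin 6) ℂ) (σ k l m : ℤ) :
    serre16 t x σ k l m =
      (fun f : ℤ → ℤ → ℤ → Matrix (Fin 6) (Fin 6) ℂ =>
        f k l m + f k m l + f l k m + f l m k + f m k l + f m l k)
      (fun a b c => t ^ 3 • (x (a - σ) * x b * x c)
        - (t + t⁻¹) • (x a * x (b - σ) * x c) + t⁻¹ ^ 3 • (x a * x b * x (c - σ))) :=
  sum_perm_three (fun i j h =>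
    (fun a b c => t ^ 3 • (x (a - σ) * x b * x c)
        - (t + t⁻¹) • (x a * x (b - σ) * x c) + t⁻¹ ^ 3 • (x a * x b * x (c - σ)))
      (![k, l, m] i) (![k, l, m] j) (![k, l, m] h))

theorem serre17_eq (t : ℂ) (x : ℤ → Matrix (Fin 6) (Fin 6) ℂ) (σ k l m : ℤ) :
    serre17 t x σ k l m =
      (fun f : ℤ → ℤ → ℤ → Matrix (Fin 6) (Fin 6) ℂ =>
        f k l m + f k m l + f l k m + f l m k + f m k l + f m l k)
      (fun a b c => t⁻¹ ^ 3 • (x (a + σ) * x b * x c)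
        - (t + t⁻¹) • (x a * x (b + σ) * x c) + t ^ 3 • (x a * x b * x (c + σ))) :=
  sum_perm_three (fun i j h =>
    (fun a b c => t⁻¹ ^ 3 • (x (a + σ) * x b * x c)
        - (t + t⁻¹) • (x a * x (b + σ) * x c) + t ^ 3 • (x a * x b * x (c + σ)))
      (![k, l, m] i) (![k, l, m] j) (![k, l, m] h))

theorem cyc_ne (t : ℂ) (ht : ∀ n : ℕ, 0 < n → t ^ n ≠ 1) : 1 - t ^ 2 + t ^ 4 ≠ 0 := by
  intro h
  apply ht 12 (by norm_num)
  linear_combination (t ^ 2 + 1) * (t ^ 6 - 1) * h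

theorem nu_eq (t : ℂ) (ht0 : t ≠ 0) : nuC t = 
    (1 + t ^ 2) * (1 - t ^ 2 + t ^ 4 - t ^ 6 + t ^ 8) * (t⁻¹ ^ 3 / (1 - t ^ 2 + t ^ 4)) := by
  unfold nuC; ring

theorem mu_eq (t : ℂ) (ht0 : t ≠ 0) : muC t = 
    t ^ 2 * (1 + t ^ 4) * (1 + t ^ 2) * (t⁻¹ ^ 3 / (1 - t ^ 2 + t ^ 4)) := by
  unfold muC; field_simp

theorem drinfeld_serre_W2 (t : ℂ) (ht0 : t ≠ 0) (ht : ∀ n : ℕ, 0 < n → t ^ n ≠ 1)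
    (k l m : ℤ) :
    serre16 t (xp t) 1 k l m = 0
    ∧ serre16 t (xm t) (-1) k l m = 0
    ∧ serre17 t (xp t) 1 k l m = 0
    ∧ serre17 t (xm t) (-1) k l m = 0 := by
  have hq : qC t ≠ 0 := pow_ne_zero 2 ht0
  have h1 : (-1 : ℂ) ≠ 0 := by norm_num
  refine ⟨?_, ?_, ?_, ?_⟩
  all_goals
    first | rw [serre16_eq] | rw [serre17_eq]
    beta_reduce
    simp only [xp_eq, xm_eq, xpA_mul, xmA_mul, sub_neg_eq_add, ← sub_eq_add_neg,
      zpow_add_one₀ hq, zpow_sub_one₀ hq, zpow_add_one₀ h1, zpow_sub_one₀ h1,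
      smul_add, Matrix.smul_single, smul_eq_mul]
    rw [nu_eq t ht0, mu_eq t ht0, qC]
    generalize t⁻¹ ^ 3 / (1 - t ^ 2 + t ^ 4) = w
    generalize tfour t = Q
    generalize (t ^ 2) ^ k = A
    generalize (t ^ 2) ^ l = B
    generalize (t ^ 2) ^ m = C
    generalize (-1 : ℂ) ^ k = a
    generalize (-1 : ℂ) ^ l = b
    generalize (-1 : ℂ) ^ m = c
    ext i j
    simp only [Matrix.add_apply, Matrix.sub_apply, Matrix.single_apply, Matrix.zero_apply]
    fin_cases i <;> fin_cases j <;> simp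
    all_goals
      field_simp
      ring
end
end

section
/- There do not exist nonzero complex numbers α^+, α^-, β^+, β^- and a ℂ-algebra homomorphism θ : U_q^τ → U_q(Lsl₃) such that θ(X_0^+) = α^+(x_1^+ + β^+ x_2^+) and θ(X_0^-) = α^-(x_1^- + β^- x_2^-). -/
noncomputable section

/-- The t-integer `[n]_t = (tⁿ - t⁻ⁿ)/(t - t⁻¹)`. -/
def tnum (t : ℂ) (n : ℕ) : ℂ := (t ^ n - t⁻¹ ^ n) / (t - t⁻¹)

/-- The t-factorial `[n]_t! = [n]_t [n-1]_t ⋯ [1]_t`. -/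
def tfac (t : ℂ) (n : ℕ) : ℂ := ∏ i ∈ Finset.range n, tnum t (i + 1)

/-- Generators of the twisted quantum loop algebra `U_q^τ` of type `A₂⁽²⁾`:
`X₀±, X₁±, K₀±¹, K₁±¹`. -/
inductive TGen : Type
  | X0p | X0m | X1p | X1m | K0 | K0i | K1 | K1i

/-- The defining relations of `U_q^τ` (with `q = t²`). -/
inductive TRel (t : ℂ) : FreeAlgebra ℂ TGen → FreeAlgebra ℂ TGen → Prop
  | k0_inv : TRel t (FreeAlgebra.ι ℂ TGen.K0 * FreeAlgebra.ι ℂ TGen.K0i) 1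
  | k0_inv' : TRel t (FreeAlgebra.ι ℂ TGen.K0i * FreeAlgebra.ι ℂ TGen.K0) 1
  | k1_inv : TRel t (FreeAlgebra.ι ℂ TGen.K1 * FreeAlgebra.ι ℂ TGen.K1i) 1
  | k1_inv' : TRel t (FreeAlgebra.ι ℂ TGen.K1i * FreeAlgebra.ι ℂ TGen.K1) 1
  | k1_def : TRel t (FreeAlgebra.ι ℂ TGen.K1)
      (FreeAlgebra.ι ℂ TGen.K0i * FreeAlgebra.ι ℂ TGen.K0i)
  | k0_x1p : TRel t
      (FreeAlgebra.ι ℂ TGen.K0 * FreeAlgebra.ι ℂ TGen.X1p * FreeAlgebra.ι ℂ TGen.K0i)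
      (((t ^ 2) ^ 2)⁻¹ • FreeAlgebra.ι ℂ TGen.X1p)
  | k0_x0p : TRel t
      (FreeAlgebra.ι ℂ TGen.K0 * FreeAlgebra.ι ℂ TGen.X0p * FreeAlgebra.ι ℂ TGen.K0i)
      (t ^ 2 • FreeAlgebra.ι ℂ TGen.X0p)
  | k0_x1m : TRel t
      (FreeAlgebra.ι ℂ TGen.K0 * FreeAlgebra.ι ℂ TGen.X1m * FreeAlgebra.ι ℂ TGen.K0i)
      ((t ^ 2) ^ 2 • FreeAlgebra.ι ℂ TGen.X1m)
  | k0_x0m : TRel t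
      (FreeAlgebra.ι ℂ TGen.K0 * FreeAlgebra.ι ℂ TGen.X0m * FreeAlgebra.ι ℂ TGen.K0i)
      ((t ^ 2)⁻¹ • FreeAlgebra.ι ℂ TGen.X0m)
  | comm_x1p_x0m : TRel t
      (FreeAlgebra.ι ℂ TGen.X1p * FreeAlgebra.ι ℂ TGen.X0m)
      (FreeAlgebra.ι ℂ TGen.X0m * FreeAlgebra.ι ℂ TGen.X1p)
  | comm_x0p_x1m : TRel t
      (FreeAlgebra.ι ℂ TGen.X0p * FreeAlgebra.ι ℂ TGen.X1m)
      (FreeAlgebra.ι ℂ TGen.X1m * FreeAlgebra.ι ℂ TGen.X0p)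
  | comm_x0p_x0m : TRel t
      (FreeAlgebra.ι ℂ TGen.X0p * FreeAlgebra.ι ℂ TGen.X0m -
        FreeAlgebra.ι ℂ TGen.X0m * FreeAlgebra.ι ℂ TGen.X0p)
      ((t - t⁻¹)⁻¹ • (FreeAlgebra.ι ℂ TGen.K0 - FreeAlgebra.ι ℂ TGen.K0i))
  | comm_x1p_x1m : TRel t
      (FreeAlgebra.ι ℂ TGen.X1p * FreeAlgebra.ι ℂ TGen.X1m -
        FreeAlgebra.ι ℂ TGen.X1m * FreeAlgebra.ι ℂ TGen.X1p)
      (((t ^ 2) ^ 2 - ((t ^ 2) ^ 2)⁻¹)⁻¹ •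
        (FreeAlgebra.ι ℂ TGen.K1 - FreeAlgebra.ι ℂ TGen.K1i))
  | serre1p : TRel t
      (FreeAlgebra.ι ℂ TGen.X0p * FreeAlgebra.ι ℂ TGen.X1p ^ 2 -
        ((t ^ 2) ^ 2 + ((t ^ 2) ^ 2)⁻¹) •
          (FreeAlgebra.ι ℂ TGen.X1p * FreeAlgebra.ι ℂ TGen.X0p * FreeAlgebra.ι ℂ TGen.X1p) +
        FreeAlgebra.ι ℂ TGen.X1p ^ 2 * FreeAlgebra.ι ℂ TGen.X0p) 0
  | serre1m : TRel t
      (FreeAlgebra.ι ℂ TGen.X0m * FreeAlgebra.ι ℂ TGen.X1m ^ 2 -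
        ((t ^ 2) ^ 2 + ((t ^ 2) ^ 2)⁻¹) •
          (FreeAlgebra.ι ℂ TGen.X1m * FreeAlgebra.ι ℂ TGen.X0m * FreeAlgebra.ι ℂ TGen.X1m) +
        FreeAlgebra.ι ℂ TGen.X1m ^ 2 * FreeAlgebra.ι ℂ TGen.X0m) 0
  | serre2p : TRel t
      (∑ r ∈ Finset.range 6,
        ((-1 : ℂ) ^ r * (tfac t (5 - r) * tfac t r)⁻¹) •
          (FreeAlgebra.ι ℂ TGen.X0p ^ (5 - r) * FreeAlgebra.ι ℂ TGen.X1p *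
            FreeAlgebra.ι ℂ TGen.X0p ^ r)) 0
  | serre2m : TRel t
      (∑ r ∈ Finset.range 6,
        ((-1 : ℂ) ^ r * (tfac t (5 - r) * tfac t r)⁻¹) •
          (FreeAlgebra.ι ℂ TGen.X0m ^ (5 - r) * FreeAlgebra.ι ℂ TGen.X1m *
            FreeAlgebra.ι ℂ TGen.X0m ^ r)) 0

/-- The twisted quantum loop algebra `U_q^τ` of type `A₂⁽²⁾`, presented by generators
and relations. -/
abbrev Utau (t : ℂ) : Type := RingQuot (TRel t)

/-- The generators of `U_q^τ`, as elements of the presented algebra. -/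
def tgen (t : ℂ) (g : TGen) : Utau t :=
  RingQuot.mkAlgHom ℂ (TRel t) (FreeAlgebra.ι ℂ g)

/-- Generators of the quantum loop algebra `U_q(Lsl₃)`:
`x_i±, k_i±¹` for `i ∈ {0,1,2}`. -/
inductive LGen : Type
  | xp (i : Fin 3) | xm (i : Fin 3) | k (i : Fin 3) | ki (i : Fin 3)

/-- The affine Cartan matrix of type `A₂⁽¹⁾`. -/
def CM (i j : Fin 3) : ℤ := if i = j then 2 else -1

/-- The defining relations of `U_q(Lsl₃)` (with `q = t²`). -/
inductive LRel (t : ℂ) : FreeAlgebra ℂ LGen → FreeAlgebra ℂ LGen → Prop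
  | k_inv (i : Fin 3) :
      LRel t (FreeAlgebra.ι ℂ (LGen.k i) * FreeAlgebra.ι ℂ (LGen.ki i)) 1
  | k_inv' (i : Fin 3) :
      LRel t (FreeAlgebra.ι ℂ (LGen.ki i) * FreeAlgebra.ι ℂ (LGen.k i)) 1
  | k_comm (i j : Fin 3) :
      LRel t (FreeAlgebra.ι ℂ (LGen.k i) * FreeAlgebra.ι ℂ (LGen.k j))
        (FreeAlgebra.ι ℂ (LGen.k j) * FreeAlgebra.ι ℂ (LGen.k i))
  | k_xp (i j : Fin 3) : LRel t
      (FreeAlgebra.ι ℂ (LGen.k i) * FreeAlgebra.ι ℂ (LGen.xp j) *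
        FreeAlgebra.ι ℂ (LGen.ki i))
      (((t ^ 2) ^ (CM i j)) • FreeAlgebra.ι ℂ (LGen.xp j))
  | k_xm (i j : Fin 3) : LRel t
      (FreeAlgebra.ι ℂ (LGen.k i) * FreeAlgebra.ι ℂ (LGen.xm j) *
        FreeAlgebra.ι ℂ (LGen.ki i))
      (((t ^ 2) ^ (-CM i j)) • FreeAlgebra.ι ℂ (LGen.xm j))
  | x_comm (i j : Fin 3) : LRel t
      (FreeAlgebra.ι ℂ (LGen.xp i) * FreeAlgebra.ι ℂ (LGen.xm j) -
        FreeAlgebra.ι ℂ (LGen.xm j) * FreeAlgebra.ι ℂ (LGen.xp i))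
      (if i = j then
        (t ^ 2 - (t ^ 2)⁻¹)⁻¹ • (FreeAlgebra.ι ℂ (LGen.k i) - FreeAlgebra.ι ℂ (LGen.ki i))
       else 0)
  | serre_p (i j : Fin 3) (h : i ≠ j) : LRel t
      (FreeAlgebra.ι ℂ (LGen.xp i) ^ 2 * FreeAlgebra.ι ℂ (LGen.xp j) -
        (t ^ 2 + (t ^ 2)⁻¹) •
          (FreeAlgebra.ι ℂ (LGen.xp i) * FreeAlgebra.ι ℂ (LGen.xp j) *
            FreeAlgebra.ι ℂ (LGen.xp i)) +
        FreeAlgebra.ι ℂ (LGen.xp j) * FreeAlgebra.ι ℂ (LGen.xp i) ^ 2) 0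
  | serre_m (i j : Fin 3) (h : i ≠ j) : LRel t
      (FreeAlgebra.ι ℂ (LGen.xm i) ^ 2 * FreeAlgebra.ι ℂ (LGen.xm j) -
        (t ^ 2 + (t ^ 2)⁻¹) •
          (FreeAlgebra.ι ℂ (LGen.xm i) * FreeAlgebra.ι ℂ (LGen.xm j) *
            FreeAlgebra.ι ℂ (LGen.xm i)) +
        FreeAlgebra.ι ℂ (LGen.xm j) * FreeAlgebra.ι ℂ (LGen.xm i) ^ 2) 0
  | k_prod : LRel t
      (FreeAlgebra.ι ℂ (LGen.k 0) * FreeAlgebra.ι ℂ (LGen.k 1) *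
        FreeAlgebra.ι ℂ (LGen.k 2)) 1

/-- The (untwisted) quantum loop algebra `U_q(Lsl₃)`, presented by generators and
relations. -/
abbrev ULsl3 (t : ℂ) : Type := RingQuot (LRel t)

/-- The generators of `U_q(Lsl₃)`, as elements of the presented algebra. -/
def lgen (t : ℂ) (g : LGen) : ULsl3 t :=
  RingQuot.mkAlgHom ℂ (LRel t) (FreeAlgebra.ι ℂ g)

/-- The representation space: functions on `ℤ³`. -/
abbrev RepV : Type := ℤ → ℤ → ℤ → ℂ

/-- The quantum integer `[n]_q`. -/
def qn (q : ℂ) (n : ℤ) : ℂ := (q ^ n - (q ^ n)⁻¹) * (q - q⁻¹)⁻¹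

/-- A weighted shift operator on functions on `ℤ³`. -/
def wshift (w : ℤ → ℤ → ℤ → ℂ) (i j k : ℤ) : Module.End ℂ RepV where
  toFun f := fun a b c => w a b c * f (a + i) (b + j) (c + k)
  map_add' f g := by
    funext a b c
    simp [mul_add]
  map_smul' r f := by
    funext a b c
    simp only [Pi.smul_apply, smul_eq_mul, RingHom.id_apply]
    ring

theorem wshift_apply (w : ℤ → ℤ → ℤ → ℂ) (i j k : ℤ) (f : RepV) (a b c : ℤ) :
    wshift w i j k f a b c = w a b c * f (a + i) (b + j) (c + k) := rfl

/-- Action of the generators of `U_q(Lsl₃)` by weighted shifts. -/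
def repGen (q : ℂ) : LGen → Module.End ℂ RepV
  | LGen.xp 0 => wshift (fun a _ _ => qn q (a + 1)) 1 0 (-1)
  | LGen.xp 1 => wshift (fun _ b _ => qn q (b + 1)) (-1) 1 0
  | LGen.xp 2 => wshift (fun _ _ c => qn q (c + 1)) 0 (-1) 1
  | LGen.xm 0 => wshift (fun _ _ c => qn q (c + 1)) (-1) 0 1
  | LGen.xm 1 => wshift (fun a _ _ => qn q (a + 1)) 1 (-1) 0
  | LGen.xm 2 => wshift (fun _ b _ => qn q (b + 1)) 0 1 (-1)
  | LGen.k 0 => wshift (fun a _ c => q ^ c * (q ^ a)⁻¹) 0 0 0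
  | LGen.k 1 => wshift (fun a b _ => q ^ a * (q ^ b)⁻¹) 0 0 0
  | LGen.k 2 => wshift (fun _ b c => q ^ b * (q ^ c)⁻¹) 0 0 0
  | LGen.ki 0 => wshift (fun a _ c => q ^ a * (q ^ c)⁻¹) 0 0 0
  | LGen.ki 1 => wshift (fun a b _ => q ^ b * (q ^ a)⁻¹) 0 0 0
  | LGen.ki 2 => wshift (fun _ b c => q ^ c * (q ^ b)⁻¹) 0 0 0

theorem repGen_rel (t : ℂ) (ht0 : t ≠ 0) (ht : ∀ n : ℕ, 0 < n → t ^ n ≠ 1)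
    ⦃x y : FreeAlgebra ℂ LGen⦄ (h : LRel t x y) :
    FreeAlgebra.lift ℂ (repGen (t ^ 2)) x = FreeAlgebra.lift ℂ (repGen (t ^ 2)) y := by
  have hq0 : t ^ 2 ≠ 0 := pow_ne_zero _ ht0
  have hq4 : (t ^ 2) ^ 2 - 1 ≠ 0 := by
    rw [← pow_mul]; exact sub_ne_zero.2 (ht _ (by norm_num))
  generalize hq : t ^ 2 = q at *
  have hq1 : q - q⁻¹ ≠ 0 := by
    intro h0
    apply hq4
    field_simp at h0
    linear_combination h0
  have hd : q - q⁻¹ = (q ^ 2 - 1) / q := by field_simp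
  have hz : ∀ n : ℤ, q ^ n ≠ 0 := fun n => zpow_ne_zero n hq0
  have e1 : ∀ n : ℤ, q ^ (n + 1) = q ^ n * q := fun n => zpow_add_one₀ hq0 n
  have e2 : ∀ n : ℤ, q ^ (n + -1) = q ^ n * q⁻¹ := fun n => zpow_sub_one₀ hq0 n
  have e3 : ∀ n : ℤ, n + 1 + 1 + -1 = n + 1 := fun n => by ring
  have e4 : ∀ n : ℤ, n + 1 + -1 = n := fun n => by ring
  have e5 : ∀ n : ℤ, n + -1 + 1 = n := fun n => by ring
  have e6 : q ^ (-2 : ℤ) = (q ^ 2)⁻¹ := by rw [zpow_neg]; norm_cast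
  have e7 : q ^ (2 : ℤ) = q ^ 2 := by norm_cast
  have e8 : q ^ (-1 : ℤ) = q⁻¹ := by simp
  cases h with
  | k_inv i =>
    ext f a b c
    have := hz a; have := hz b; have := hz c
    fin_cases i <;> simp [repGen, wshift_apply] <;> field_simp
  | k_inv' i =>
    ext f a b c
    have := hz a; have := hz b; have := hz c
    fin_cases i <;> simp [repGen, wshift_apply] <;> field_simp
  | k_comm i j =>
    ext f a b c
    fin_cases i <;> fin_cases j <;> simp [repGen, wshift_apply] <;> ring
  | k_xp i j =>
    ext f a b c
    have := hz a; have := hz b; have := hz c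
    fin_cases i <;> fin_cases j <;>
      simp [repGen, wshift_apply, CM, hq, e1, e2, e6, e7, e8] <;> field_simp
  | k_xm i j =>
    ext f a b c
    have := hz a; have := hz b; have := hz c
    fin_cases i <;> fin_cases j <;>
      simp [repGen, wshift_apply, CM, hq, e1, e2, e6, e7, e8] <;> field_simp
  | x_comm i j =>
    ext f a b c
    have := hz a; have := hz b; have := hz c
    fin_cases i <;> fin_cases j <;>
      simp [repGen, wshift_apply, qn, hq, e1, e2, e4, e5, hd] <;> field_simp <;> ring
  | serre_p i j hij =>
    ext f a b c
    have := hz a; have := hz b; have := hz c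
    fin_cases i <;> fin_cases j <;>
      first
      | exact absurd rfl hij
      | (simp [repGen, wshift_apply, qn, hq, e1, e2, e3, e4, e5, pow_two]
         generalize q - q⁻¹ = d at *
         field_simp
         ring)
  | serre_m i j hij =>
    ext f a b c
    have := hz a; have := hz b; have := hz c
    fin_cases i <;> fin_cases j <;>
      first
      | exact absurd rfl hij
      | (simp [repGen, wshift_apply, qn, hq, e1, e2, e3, e4, e5, pow_two]
         generalize q - q⁻¹ = d at *
         field_simp
         ring)
  | k_prod =>
    ext f a b c
    have := hz a; have := hz b; have := hz c
    simp [repGen, wshift_apply]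
    field_simp


/-- If `K E K⁻¹ = q E` and `[E, F]` is a multiple of `K - K⁻¹`, then `[E, F]` satisfies a
quadratic relation with `E`. -/
theorem quad_rel {A : Type*} [Ring A] [Algebra ℂ A] (q s : ℂ) (hq0 : q ≠ 0) (E K Ki D : A)
    (h2 : Ki * K = 1) (h3 : K * E * Ki = q • E)
    (hD : D = s • (K - Ki)) :
    D * (E * E) - (q + q⁻¹) • (E * (D * E)) + E * (E * D) = 0 := by
  have hK : K * E = q • (E * K) := by
    calc K * E = (K * E * Ki) * K := by rw [mul_assoc (K * E), h2, mul_one]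
      _ = _ := by rw [h3, smul_mul_assoc]
  have hKi : Ki * E = q⁻¹ • (E * Ki) := by
    calc Ki * E = q⁻¹ • (Ki * (q • E) ) := by
          rw [mul_smul_comm, smul_smul, inv_mul_cancel₀ hq0, one_smul]
      _ = q⁻¹ • (Ki * K * E * Ki) := by rw [← h3]; simp only [mul_assoc]
      _ = _ := by rw [h2, one_mul]
  have hKE : K * (E * E) = (q * q) • (E * (E * K)) := by
    rw [← mul_assoc, hK, smul_mul_assoc, mul_assoc, hK, mul_smul_comm, smul_smul]
  have hKiE : Ki * (E * E) = (q⁻¹ * q⁻¹) • (E * (E * Ki)) := by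
    rw [← mul_assoc, hKi, smul_mul_assoc, mul_assoc, hKi, mul_smul_comm, smul_smul]
  subst hD
  simp only [smul_mul_assoc, mul_smul_comm, sub_mul, mul_sub, hK, hKi, hKE, hKiE]
  match_scalars <;> field_simp <;> ring

/-- The operator `[E, F]` acts diagonally. -/
theorem comm_diag (q : ℂ) (hq0 : q ≠ 0) (hq4 : q ^ 2 - 1 ≠ 0) (αp αm βp βm : ℂ) (f : RepV)
    (a b c : ℤ) (E F : Module.End ℂ RepV)
    (hE : E = αp • (repGen q (LGen.xp 1) + βp • repGen q (LGen.xp 2)))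
    (hF : F = αm • (repGen q (LGen.xm 1) + βm • repGen q (LGen.xm 2))) :
    (E * F - F * E) f a b c =
      αp * αm * (qn q (a - b) + βp * βm * qn q (b - c)) * f a b c := by
  have hd : q - q⁻¹ = (q ^ 2 - 1) / q := by field_simp
  have hz : ∀ n : ℤ, q ^ n ≠ 0 := fun n => zpow_ne_zero n hq0
  have e1 : ∀ n : ℤ, q ^ (n + 1) = q ^ n * q := fun n => zpow_add_one₀ hq0 n
  have e2 : ∀ n : ℤ, q ^ (n + -1) = q ^ n * q⁻¹ := fun n => zpow_sub_one₀ hq0 n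
  have e0 : ∀ m n : ℤ, q ^ (m - n) = q ^ m / q ^ n := fun m n => zpow_sub₀ hq0 m n
  have e4 : ∀ n : ℤ, n + 1 + -1 = n := fun n => by ring
  have e5 : ∀ n : ℤ, n + -1 + 1 = n := fun n => by ring
  have := hz a; have := hz b; have := hz c
  subst hE hF
  simp [repGen, wshift_apply, qn, e0, e1, e2, e4, e5, hd]
  field_simp
  ring

/-- There is no ℂ-algebra morphism `θ : U_q^τ → U_q(Lsl₃)` with
`θ(X₀⁺) = α⁺(x₁⁺ + β⁺x₂⁺)` and `θ(X₀⁻) = α⁻(x₁⁻ + β⁻x₂⁻)` for nonzero scalars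
`α⁺, α⁻, β⁺, β⁻`. -/
theorem no_algebra_morphism (t : ℂ) (ht0 : t ≠ 0) (ht : ∀ n : ℕ, 0 < n → t ^ n ≠ 1) :
    ¬ ∃ (αp αm βp βm : ℂ) (θ : Utau t →ₐ[ℂ] ULsl3 t),
        αp ≠ 0 ∧ αm ≠ 0 ∧ βp ≠ 0 ∧ βm ≠ 0 ∧
        θ (tgen t TGen.X0p) = αp • (lgen t (LGen.xp 1) + βp • lgen t (LGen.xp 2)) ∧
        θ (tgen t TGen.X0m) = αm • (lgen t (LGen.xm 1) + βm • lgen t (LGen.xm 2)) := by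
  rintro ⟨αp, αm, βp, βm, θ, hαp, hαm, -, -, hXp, hXm⟩
  have hq0 : t ^ 2 ≠ 0 := pow_ne_zero _ ht0
  have hq4 : (t ^ 2) ^ 2 - 1 ≠ 0 := by
    rw [← pow_mul]; exact sub_ne_zero.2 (ht _ (by norm_num))
  have hq3 : (t ^ 2) ^ 3 - 1 ≠ 0 := by
    rw [← pow_mul]; exact sub_ne_zero.2 (ht _ (by norm_num))
  have hq8 : (t ^ 2) ^ 4 - 1 ≠ 0 := by
    rw [← pow_mul]; exact sub_ne_zero.2 (ht _ (by norm_num))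
  have hq2 : t ^ 2 - 1 ≠ 0 := sub_ne_zero.2 (ht _ (by norm_num))
  have ht1 : t - t⁻¹ ≠ 0 := by
    intro h0
    apply hq2
    field_simp at h0
    linear_combination h0
  -- the representation of the target, and the composite with `θ`
  let ρ : ULsl3 t →ₐ[ℂ] Module.End ℂ RepV :=
    RingQuot.liftAlgHom ℂ ⟨FreeAlgebra.lift ℂ (repGen (t ^ 2)), repGen_rel t ht0 ht⟩
  have hρ : ∀ g, ρ (lgen t g) = repGen (t ^ 2) g := by
    intro g
    simp [ρ, lgen]
  let ψ : Utau t →ₐ[ℂ] Module.End ℂ RepV := ρ.comp θ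
  have hE : ψ (tgen t TGen.X0p) =
      αp • (repGen (t ^ 2) (LGen.xp 1) + βp • repGen (t ^ 2) (LGen.xp 2)) := by
    simp only [ψ, AlgHom.comp_apply, hXp, map_smul, map_add, hρ]
  have hF : ψ (tgen t TGen.X0m) =
      αm • (repGen (t ^ 2) (LGen.xm 1) + βm • repGen (t ^ 2) (LGen.xm 2)) := by
    simp only [ψ, AlgHom.comp_apply, hXm, map_smul, map_add, hρ]
  -- relations of `U_q^τ` that are used
  have r1 : ψ (tgen t TGen.K0) * ψ (tgen t TGen.K0i) = 1 := by
    have h := RingQuot.mkAlgHom_rel ℂ (TRel.k0_inv (t := t))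
    rw [map_mul, map_one] at h
    rw [← map_mul, tgen, tgen, h, map_one]
  have r2 : ψ (tgen t TGen.K0i) * ψ (tgen t TGen.K0) = 1 := by
    have h := RingQuot.mkAlgHom_rel ℂ (TRel.k0_inv' (t := t))
    rw [map_mul, map_one] at h
    rw [← map_mul, tgen, tgen, h, map_one]
  have r3 : ψ (tgen t TGen.K0) * ψ (tgen t TGen.X0p) * ψ (tgen t TGen.K0i) =
      t ^ 2 • ψ (tgen t TGen.X0p) := by
    have h := RingQuot.mkAlgHom_rel ℂ (TRel.k0_x0p (t := t))
    rw [map_mul, map_mul, map_smul] at h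
    rw [← map_mul, ← map_mul, ← map_smul, tgen, tgen, tgen, h]
  have r4 : ψ (tgen t TGen.X0p) * ψ (tgen t TGen.X0m) -
      ψ (tgen t TGen.X0m) * ψ (tgen t TGen.X0p) =
      (t - t⁻¹)⁻¹ • (ψ (tgen t TGen.K0) - ψ (tgen t TGen.K0i)) := by
    have h := RingQuot.mkAlgHom_rel ℂ (TRel.comm_x0p_x0m (t := t))
    rw [map_sub, map_mul, map_mul, map_smul, map_sub] at h
    rw [← map_mul, ← map_mul, ← map_sub, ← map_sub, ← map_smul, tgen, tgen, tgen, tgen, h]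
  have key := quad_rel (t ^ 2) _ hq0 _ _ _ _ r2 r3 r4
  have diag := fun f a b c => comm_diag (t ^ 2) hq0 hq4 αp αm βp βm f a b c _ _ hE hF
  generalize ψ (tgen t TGen.X0p) * ψ (tgen t TGen.X0m) -
      ψ (tgen t TGen.X0m) * ψ (tgen t TGen.X0p) = D at key diag
  generalize ψ (tgen t TGen.X0p) = E at key hE
  generalize t ^ 2 = q at *
  have hEf : ∀ (f : RepV) (a b c : ℤ), E f a b c =
      αp * (qn q (b + 1) * f (a - 1) (b + 1) c + βp * (qn q (c + 1) * f a (b - 1) (c + 1))) := by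
    intro f a b c
    simp [hE, repGen, wshift_apply, sub_eq_add_neg]
    ring
  let f : RepV := fun a b c => if a = 2 ∧ b = 2 ∧ c = 0 then 1 else 0
  have ev := congrFun (congrFun (congrFun (LinearMap.congr_fun key f) 4) 0) 0
  simp only [LinearMap.add_apply, LinearMap.sub_apply, LinearMap.smul_apply, Module.End.mul_apply,
    Pi.add_apply, Pi.sub_apply, Pi.smul_apply, smul_eq_mul, diag, hEf, f] at ev
  norm_num at ev
  have hd : q - q⁻¹ = (q ^ 2 - 1) / q := by field_simp
  have z1 : qn q 1 = 1 := by
    simp only [qn, zpow_one, hd]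
    field_simp
  have z2 : qn q 2 = q + q⁻¹ := by
    have : q ^ (2 : ℤ) = q ^ 2 := by norm_cast
    simp only [qn, this, hd]
    field_simp
    ring
  have z4 : qn q 4 = (q + q⁻¹) * (q ^ 2 + (q ^ 2)⁻¹) := by
    have : q ^ (4 : ℤ) = q ^ 4 := by norm_cast
    simp only [qn, this, hd]
    field_simp
    ring
  have z0 : qn q 0 = 0 := by simp [qn]
  simp only [z0, z1, z2, z4] at ev
  have fin : αp ^ 3 * αm * ((q ^ 3 - 1) * (q - 1) * (q ^ 4 - 1) ^ 2) = 0 := by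
    field_simp at ev
    linear_combination (q ^ 2 - 1) ^ 2 * ev
  exact mul_ne_zero (mul_ne_zero (pow_ne_zero 3 hαp) hαm)
    (mul_ne_zero (mul_ne_zero hq3 hq2) (pow_ne_zero 2 hq8)) fin
end
end
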